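/- Let 0 < α < 1, T > 0, and let M₁, M₂ > 0 satisfy M₁/(1+z) ≤ E_{α,1}(−z) ≤ M₂/(1+z) for all real z ≥ 0. Set Q_{α,T} = 2M₂T √(2(M₁²(1−α)² + M₂²)) / (M₁(1−α)). Fix positive integers N₁, N₂ and, on H = ℓ²(J₂), define for t ∈ [0,T] the bounded linear maps: (𝔸(t)g)_j = (E_{α,1}(−λ_j t^α)/E_{α,1}(−λ_j T^α)) g_j if j₁ ≤ N₁ and j₂ ≤ N₂ and 0 otherwise; (𝔹(t)g)_j = E_{α,1}(−λ_j t^α) g_j if j₁ ≤ N₁ and j₂ ≤ N₂ and 0 otherwise; and 𝔻(t,s) = 𝔸(t)∘𝔹(s). Let (Ω,ℱ,P) be a probability space, ψ : Ω → H strongly measurable with E‖ψ‖² < ∞, and f : [0,T] × H → H jointly measurable with sup_{t∈[0,T]} ‖f(t,0)‖ < ∞ and ‖f(t,u) − f(t,v)‖ ≤ K‖u−v‖ for all t, u, v, where 0 < K < Q_{α,T}^{−1}. Let X_T be the Banach space of jointly measurable maps w : [0,T] × Ω → H (identified when equal for every t almost surely) with norm ‖w‖_{X_T} = sup_{t∈[0,T]}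 (E‖w(t,·)‖²)^{1/2} < ∞. Then there exists a unique w ∈ X_T such that for every t ∈ [0,T], almost surely w(t,·) = 𝔸(t)ψ + ∫₀^t 𝔹(t−s) f(s, w(s,·)) ds − ∫₀^T 𝔻(t, T−s) f(s, w(s,·)) ds. -/

import Mathlib

open Real MeasureTheory ProbabilityTheory intervalIntegral

/-- The Mittag-Leffler function `E_{a,b}(z) = ∑_{i=0}^∞ z^i / Γ(a i + b)`. -/
noncomputable def mittagLeffler (a b z : ℝ) : ℝ :=
  ∑' i : ℕ, z ^ i / Real.Gamma (a * i + b)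

/-- Pairs of positive integers. -/
abbrev J2 := ℕ+ × ℕ+

/-- `λ_j = j₁² + j₂²`. -/
def lam2 (j : J2) : ℝ := ((j.1 : ℕ) : ℝ) ^ 2 + ((j.2 : ℕ) : ℝ) ^ 2

/-- The Hilbert space `ℓ²(J₂)` of square-summable real families. -/
noncomputable abbrev H2 := lp (fun _ : J2 => ℝ) 2

/-- The constant `Q_{α,T} = 2M₂T√(2(M₁²(1−α)²+M₂²))/(M₁(1−α))`. -/
noncomputable def Qconst (α T M₁ M₂ : ℝ) : ℝ :=
  2 * M₂ * T * Real.sqrt (2 * (M₁ ^ 2 * (1 - α) ^ 2 + M₂ ^ 2)) / (M₁ * (1 - α))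

/-- `w` is a solution in `X_T` of the truncated regularized integral equation. -/
def IsXTSol {Ω : Type*} [MeasureSpace Ω] (T : ℝ)
    (A B : ℝ → H2 →L[ℝ] H2) (ψ : Ω → H2) (f : ℝ → H2 → H2)
    (w : ℝ → Ω → H2) : Prop :=
  StronglyMeasurable (Function.uncurry w) ∧
  (∃ C : ℝ, ∀ t ∈ Set.Icc (0 : ℝ) T,
      Integrable (fun ω => ‖w t ω‖ ^ 2) (ℙ : Measure Ω) ∧
      (∫ ω, ‖w t ω‖ ^ 2 ∂(ℙ : Measure Ω)) ≤ C) ∧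
  (∀ t ∈ Set.Icc (0 : ℝ) T, ∀ᵐ ω ∂(ℙ : Measure Ω),
      w t ω = A t (ψ ω)
        + (∫ s in (0 : ℝ)..t, B (t - s) (f s (w s ω)))
        - ∫ s in (0 : ℝ)..T, A t (B (T - s) (f s (w s ω))))

section abstractPart
set_option linter.unusedSectionVars false
variable {E : Type*} [NormedAddCommGroup E] [NormedSpace ℝ E]

lemma abs_integrable {μ : Measure ℝ} {k : ℝ → ℝ}
    {G : ℝ → E → E} (hG1 : ∀ᵐ s ∂μ, ∀ x y, ‖G s x - G s y‖ ≤ k s * ‖x - y‖)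
    {C : ℝ} (hk : Integrable k μ) (hG0 : ∀ᵐ s ∂μ, ‖G s 0‖ ≤ k s * C)
    {u : ℝ → E} (hm : AEStronglyMeasurable (fun s => G s (u s)) μ)
    (hu : Integrable (fun s => k s * ‖u s‖) μ) : Integrable (fun s => G s (u s)) μ := by
  refine Integrable.mono' ((hk.mul_const C).add hu) hm ?_
  filter_upwards [hG1, hG0] with s h1 h0
  have := h1 (u s) 0
  simp only [sub_zero] at this
  calc ‖G s (u s)‖ = ‖G s 0 + (G s (u s) - G s 0)‖ := by congr 1; abel
    _ ≤ ‖G s 0‖ + ‖G s (u s) - G s 0‖ := norm_add_le _ _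
    _ ≤ _ := add_le_add h0 this

lemma abs_integrable_bdd {μ : Measure ℝ} {T : ℝ} (hμ : ∀ᵐ s ∂μ, s ∈ Set.Icc 0 T) {k : ℝ → ℝ}
    {G : ℝ → E → E} (hG1 : ∀ᵐ s ∂μ, ∀ x y, ‖G s x - G s y‖ ≤ k s * ‖x - y‖)
    {C : ℝ} (hk : Integrable k μ) (hk0 : ∀ s, 0 ≤ k s) (hG0 : ∀ᵐ s ∂μ, ‖G s 0‖ ≤ k s * C)
    {u : ℝ → E} (hm : AEStronglyMeasurable (fun s => G s (u s)) μ)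
    {R : ℝ} (hu : ∀ s ∈ Set.Icc 0 T, ‖u s‖ ≤ R) : Integrable (fun s => G s (u s)) μ := by
  refine Integrable.mono' ((hk.mul_const C).add (hk.mul_const R)) hm ?_
  filter_upwards [hG1, hG0, hμ] with s h1 h0 hs
  have := h1 (u s) 0
  simp only [sub_zero] at this
  calc ‖G s (u s)‖ = ‖G s 0 + (G s (u s) - G s 0)‖ := by congr 1; abel
    _ ≤ ‖G s 0‖ + ‖G s (u s) - G s 0‖ := norm_add_le _ _
    _ ≤ _ := add_le_add h0 (this.trans (mul_le_mul_of_nonneg_left (hu s hs) (hk0 s)))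

lemma abs_contr {μ : Measure ℝ} {T : ℝ} (hμ : ∀ᵐ s ∂μ, s ∈ Set.Icc 0 T) {k : ℝ → ℝ}
    {G : ℝ → E → E} (hG1 : ∀ᵐ s ∂μ, ∀ x y, ‖G s x - G s y‖ ≤ k s * ‖x - y‖)
    {C q : ℝ} (hk : Integrable k μ) (hk0 : ∀ s, 0 ≤ k s) (hq : ∫ s, k s ∂μ ≤ q)
    (hG0 : ∀ᵐ s ∂μ, ‖G s 0‖ ≤ k s * C)
    {u v : ℝ → E} (hm : AEStronglyMeasurable (fun s => G s (u s)) μ)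
    (hm' : AEStronglyMeasurable (fun s => G s (v s)) μ)
    {R r : ℝ} (hr : 0 ≤ r)
    (hu : ∀ s ∈ Set.Icc 0 T, ‖u s‖ ≤ R) (hv : ∀ s ∈ Set.Icc 0 T, ‖v s‖ ≤ R)
    (huv : ∀ s ∈ Set.Icc 0 T, ‖u s - v s‖ ≤ r) :
    ‖(∫ s, G s (u s) ∂μ) - ∫ s, G s (v s) ∂μ‖ ≤ q * r := by
  rw [← integral_sub (abs_integrable_bdd hμ hG1 hk hk0 hG0 hm hu)
    (abs_integrable_bdd hμ hG1 hk hk0 hG0 hm' hv)]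
  refine (MeasureTheory.norm_integral_le_of_norm_le (hk.mul_const r) ?_).trans ?_
  · filter_upwards [hG1, hμ] with s h1 hs
    exact (h1 _ _).trans (mul_le_mul_of_nonneg_left (huv s hs) (hk0 s))
  · rw [MeasureTheory.integral_mul_const]
    exact mul_le_mul_of_nonneg_right hq hr

lemma abs_exist [CompleteSpace E] {Ω : Type*} [MeasurableSpace Ω]
    {T : ℝ} (hT : 0 ≤ T) (μ : Measure ℝ) [SFinite μ] (hμ : ∀ᵐ s ∂μ, s ∈ Set.Icc 0 T)
    (k : ℝ → ℝ) (hk : Integrable k μ) (hk0 : ∀ s, 0 ≤ k s)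
    (q : ℝ) (hq : ∫ s, k s ∂μ ≤ q) (hq1 : q < 1)
    (G : ℝ → ℝ → E → E)
    (hG1 : ∀ t ∈ Set.Icc 0 T, ∀ᵐ s ∂μ, ∀ x y, ‖G t s x - G t s y‖ ≤ k s * ‖x - y‖)
    (C : ℝ) (hC : 0 ≤ C) (hG0 : ∀ t ∈ Set.Icc 0 T, ∀ᵐ s ∂μ, ‖G t s 0‖ ≤ k s * C)
    (hGm : ∀ w : ℝ → Ω → E, StronglyMeasurable (Function.uncurry w) →
      StronglyMeasurable (fun p : (ℝ × Ω) × ℝ => G p.1.1 p.2 (w p.2 p.1.2)))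
    (a : ℝ → Ω → E) (ham : StronglyMeasurable (Function.uncurry a))
    (D : Ω → ℝ) (hD : ∀ t ∈ Set.Icc 0 T, ∀ ω, ‖a t ω‖ ≤ D ω) :
    ∃ w : ℝ → Ω → E, StronglyMeasurable (Function.uncurry w) ∧
      (∀ t ∈ Set.Icc 0 T, ∀ ω, ‖w t ω‖ ≤ (D ω + q * C) / (1 - q)) ∧
      ∀ t ∈ Set.Icc 0 T, ∀ ω, w t ω = a t ω + ∫ s, G t s (w s ω) ∂μ := by
  have hq0 : 0 ≤ q := (integral_nonneg hk0).trans hq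
  have h1q : 0 < 1 - q := by linarith
  have hD0 : ∀ ω, 0 ≤ D ω := fun ω =>
    (norm_nonneg _).trans (hD 0 (Set.left_mem_Icc.2 hT) ω)
  set R : Ω → ℝ := fun ω => (D ω + q * C) / (1 - q) with hR
  have hR0 : ∀ ω, 0 ≤ R ω := fun ω => div_nonneg (add_nonneg (hD0 ω) (mul_nonneg hq0 hC)) h1q.le
  have hReq : ∀ ω, D ω + q * (C + R ω) = R ω := by
    intro ω; simp only [hR]; field_simp; ring
  let Φ : (ℝ → Ω → E) → ℝ → Ω → E := fun w t ω => a t ω + ∫ s, G t s (w s ω) ∂μ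
  have hΦm : ∀ w, StronglyMeasurable (Function.uncurry w) →
      StronglyMeasurable (Function.uncurry (Φ w)) := by
    intro w hw
    exact ham.add ((hGm w hw).integral_prod_right (ν := μ))
  have hsec : ∀ w : ℝ → Ω → E, StronglyMeasurable (Function.uncurry w) → ∀ t ω,
      AEStronglyMeasurable (fun s => G t s (w s ω)) μ := by
    intro w hw t ω
    exact ((hGm w hw).comp_measurable (g := fun s : ℝ => ((t, ω), s)) measurable_prodMk_left).aestronglyMeasurable
  have hΦb : ∀ w, StronglyMeasurable (Function.uncurry w) →
      ∀ ω, (∀ t ∈ Set.Icc 0 T, ‖w t ω‖ ≤ R ω) → ∀ t ∈ Set.Icc 0 T, ‖Φ w t ω‖ ≤ R ω := by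
    intro w hw ω hb t ht
    rw [← hReq ω]
    refine (norm_add_le _ _).trans (add_le_add (hD t ht ω) ?_)
    refine (MeasureTheory.norm_integral_le_of_norm_le (hk.mul_const (C + R ω)) ?_).trans ?_
    · filter_upwards [hG1 t ht, hG0 t ht, hμ] with s h1 h0 hs
      have := h1 (w s ω) 0
      simp only [sub_zero] at this
      calc ‖G t s (w s ω)‖ = ‖G t s 0 + (G t s (w s ω) - G t s 0)‖ := by congr 1; abel
        _ ≤ ‖G t s 0‖ + ‖G t s (w s ω) - G t s 0‖ := norm_add_le _ _
        _ ≤ k s * C + k s * R ω :=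
          add_le_add h0 (this.trans (mul_le_mul_of_nonneg_left (hb s hs) (hk0 s)))
        _ = _ := by ring
    · rw [MeasureTheory.integral_mul_const]
      exact mul_le_mul_of_nonneg_right hq (add_nonneg hC (hR0 ω))
  have hΦc : ∀ u v, StronglyMeasurable (Function.uncurry u) →
      StronglyMeasurable (Function.uncurry v) → ∀ ω r, 0 ≤ r →
      (∀ t ∈ Set.Icc 0 T, ‖u t ω‖ ≤ R ω) → (∀ t ∈ Set.Icc 0 T, ‖v t ω‖ ≤ R ω) →
      (∀ t ∈ Set.Icc 0 T, ‖u t ω - v t ω‖ ≤ r) →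
      ∀ t ∈ Set.Icc 0 T, ‖Φ u t ω - Φ v t ω‖ ≤ q * r := by
    intro u v hu hv ω r hr hub hvb huv t ht
    simp only [Φ, add_sub_add_left_eq_sub]
    exact abs_contr hμ (hG1 t ht) hk hk0 hq (hG0 t ht) (hsec u hu t ω) (hsec v hv t ω) hr
      hub hvb huv
  let W : ℕ → ℝ → Ω → E := fun n => Φ^[n] (fun _ _ => 0)
  have hWs : ∀ n, W (n + 1) = Φ (W n) := fun n => Function.iterate_succ_apply' _ _ _
  have hWm : ∀ n, StronglyMeasurable (Function.uncurry (W n)) := by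
    intro n
    induction n with
    | zero => exact stronglyMeasurable_const
    | succ n ih => rw [hWs]; exact hΦm _ ih
  have hWb : ∀ n ω, ∀ t ∈ Set.Icc 0 T, ‖W n t ω‖ ≤ R ω := by
    intro n ω
    induction n with
    | zero => intro t ht; simpa [W] using hR0 ω
    | succ n ih => rw [hWs]; exact hΦb _ (hWm n) ω ih
  have hWd : ∀ n ω, ∀ t ∈ Set.Icc 0 T, ‖W n t ω - W (n + 1) t ω‖ ≤ R ω * q ^ n := by
    intro n ω
    induction n with
    | zero =>
      intro t ht
      have := hWb 1 ω t ht
      simpa [W] using this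
    | succ n ih =>
      intro t ht
      have := hΦc (W n) (W (n + 1)) (hWm _) (hWm _) ω (R ω * q ^ n)
        (mul_nonneg (hR0 ω) (pow_nonneg hq0 n)) (hWb n ω) (hWb _ ω) ih t ht
      rw [← hWs (n + 1), ← hWs n] at this
      calc _ ≤ _ := this
        _ = _ := by ring
  have hconv : ∀ p : ℝ × Ω, ∃ x, Filter.Tendsto
      (fun n => ((Set.Icc 0 T) ×ˢ (Set.univ : Set Ω)).indicator (Function.uncurry (W n)) p)
      Filter.atTop (nhds x) := by
    rintro ⟨t, ω⟩
    by_cases ht : t ∈ Set.Icc 0 T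
    · have : CauchySeq (fun n => W n t ω) :=
        cauchySeq_of_le_geometric q (R ω) hq1 fun n => by
          rw [dist_eq_norm]; exact hWd n ω t ht
      obtain ⟨x, hx⟩ := cauchySeq_tendsto_of_complete this
      refine ⟨x, ?_⟩
      have h' : (t, ω) ∈ (Set.Icc 0 T) ×ˢ (Set.univ : Set Ω) := ⟨ht, trivial⟩
      simpa only [Set.indicator_of_mem h', Function.uncurry_apply_pair] using hx
    · have h' : (t, ω) ∉ (Set.Icc 0 T) ×ˢ (Set.univ : Set Ω) := fun h => ht h.1
      refine ⟨0, ?_⟩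
      simp only [Set.indicator_of_notMem h']
      exact tendsto_const_nhds
  choose w0 hw0 using hconv
  have hwm : StronglyMeasurable w0 := by
    refine stronglyMeasurable_of_tendsto Filter.atTop (f := fun n =>
      ((Set.Icc 0 T) ×ˢ (Set.univ : Set Ω)).indicator (Function.uncurry (W n))) ?_ ?_
    · intro n
      exact (hWm n).indicator (measurableSet_Icc.prod MeasurableSet.univ)
    · exact tendsto_pi_nhds.2 hw0
  let w : ℝ → Ω → E := fun t ω => w0 (t, ω)
  have hwm' : StronglyMeasurable (Function.uncurry w) := hwm
  have hlim : ∀ t ∈ Set.Icc 0 T, ∀ ω,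
      Filter.Tendsto (fun n => W n t ω) Filter.atTop (nhds (w t ω)) := by
    intro t ht ω
    have h' : (t, ω) ∈ (Set.Icc 0 T) ×ˢ (Set.univ : Set Ω) := ⟨ht, trivial⟩
    have := hw0 (t, ω)
    simpa only [Set.indicator_of_mem h', Function.uncurry_apply_pair] using this
  have hwb : ∀ ω, ∀ t ∈ Set.Icc 0 T, ‖w t ω‖ ≤ R ω := fun ω t ht =>
    le_of_tendsto (hlim t ht ω).norm (Filter.Eventually.of_forall fun n => hWb n ω t ht)
  have hdist : ∀ n ω, ∀ t ∈ Set.Icc 0 T, ‖W n t ω - w t ω‖ ≤ R ω * q ^ n / (1 - q) := by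
    intro n ω t ht
    have := dist_le_of_le_geometric_of_tendsto q (R ω) hq1 (f := fun n => W n t ω) (fun n => by
          rw [dist_eq_norm]; exact hWd n ω t ht) (hlim t ht ω) n
    rwa [dist_eq_norm] at this
  refine ⟨w, hwm', fun t ht ω => hwb ω t ht, fun t ht ω => ?_⟩
  have h1 : Filter.Tendsto (fun n => W (n + 1) t ω) Filter.atTop (nhds (w t ω)) :=
    (hlim t ht ω).comp (Filter.tendsto_add_atTop_nat 1)
  refine tendsto_nhds_unique h1 ?_
  change Filter.Tendsto (fun n => W (n + 1) t ω) Filter.atTop (nhds (Φ w t ω))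
  rw [tendsto_iff_norm_sub_tendsto_zero]
  have h2 : Filter.Tendsto (fun n : ℕ => q * (R ω * q ^ n / (1 - q))) Filter.atTop (nhds 0) := by
    have := ((tendsto_pow_atTop_nhds_zero_of_lt_one hq0 hq1).const_mul (R ω)).div_const (1 - q)
    simpa using this.const_mul q
  refine squeeze_zero (fun _ => norm_nonneg _) (fun n => ?_) h2
  rw [hWs]
  exact hΦc _ _ (hWm n) hwm' ω _ (div_nonneg (mul_nonneg (hR0 ω) (pow_nonneg hq0 n)) h1q.le)
    (hWb n ω) (hwb ω) (hdist n ω) t ht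

lemma abs_ae_integrable {Ω : Type*} [MeasurableSpace Ω] (P : Measure Ω) [IsProbabilityMeasure P]
    {T : ℝ} (μ : Measure ℝ) [SFinite μ] (hμ : ∀ᵐ s ∂μ, s ∈ Set.Icc 0 T)
    (k : ℝ → ℝ) (hk : Integrable k μ) (hkm : Measurable k) (hk0 : ∀ s, 0 ≤ k s)
    (w : ℝ → Ω → E) (hw : StronglyMeasurable (Function.uncurry w))
    (C : ENNReal) (hC : C ≠ ⊤) (hwC : ∀ t ∈ Set.Icc 0 T, ∫⁻ ω, ‖w t ω‖ₑ ∂P ≤ C) :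
    ∀ᵐ ω ∂P, Integrable (fun s => k s * ‖w s ω‖) μ := by
  have hm : Measurable (fun p : Ω × ℝ => ENNReal.ofReal (k p.2) * ‖w p.2 p.1‖ₑ) := by
    refine (hkm.comp measurable_snd).ennreal_ofReal.mul ?_
    exact hw.enorm.comp measurable_swap
  have hfin : ∫⁻ ω, ∫⁻ s, ENNReal.ofReal (k s) * ‖w s ω‖ₑ ∂μ ∂P ≠ ⊤ := by
    rw [lintegral_lintegral_swap hm.aemeasurable]
    refine ne_of_lt (lt_of_le_of_lt (b := ∫⁻ s, ENNReal.ofReal (k s) * C ∂μ) ?_ ?_)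
    · refine lintegral_mono_ae ?_
      filter_upwards [hμ] with s hs
      rw [lintegral_const_mul]
      · gcongr; exact hwC s hs
      · exact hw.enorm.comp measurable_prodMk_left
    · rw [lintegral_mul_const _ hkm.ennreal_ofReal,
        ← ofReal_integral_eq_lintegral_ofReal hk (Filter.Eventually.of_forall hk0)]
      exact ENNReal.mul_lt_top ENNReal.ofReal_lt_top hC.lt_top
  filter_upwards [ae_lt_top hm.lintegral_prod_right' hfin] with ω hω
  refine ⟨?_, ?_⟩
  · refine (hkm.stronglyMeasurable.mul ?_).aestronglyMeasurable
    exact (hw.comp_measurable (measurable_prodMk_right (y := ω))).norm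
  · rw [HasFiniteIntegral]
    refine lt_of_le_of_lt (le_of_eq ?_) hω
    refine lintegral_congr fun s => ?_
    rw [enorm_mul, Real.enorm_eq_ofReal (hk0 s), enorm_norm]

lemma abs_unique {Ω : Type*} [MeasurableSpace Ω] (P : Measure Ω) [IsProbabilityMeasure P]
    {T : ℝ} (μ : Measure ℝ) [SFinite μ] (hμ : ∀ᵐ s ∂μ, s ∈ Set.Icc 0 T)
    (k : ℝ → ℝ) (hk : Integrable k μ) (hkm : Measurable k) (hk0 : ∀ s, 0 ≤ k s)
    (q : ℝ) (hq : ∫ s, k s ∂μ ≤ q) (hq1 : q < 1)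
    (G : ℝ → ℝ → E → E)
    (hG1 : ∀ t ∈ Set.Icc 0 T, ∀ᵐ s ∂μ, ∀ x y, ‖G t s x - G t s y‖ ≤ k s * ‖x - y‖)
    (C : ℝ) (hG0 : ∀ t ∈ Set.Icc 0 T, ∀ᵐ s ∂μ, ‖G t s 0‖ ≤ k s * C)
    (hGm : ∀ w : ℝ → Ω → E, StronglyMeasurable (Function.uncurry w) →
      StronglyMeasurable (fun p : (ℝ × Ω) × ℝ => G p.1.1 p.2 (w p.2 p.1.2)))
    (a : ℝ → Ω → E)
    (w w' : ℝ → Ω → E) (hw : StronglyMeasurable (Function.uncurry w))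
    (hw' : StronglyMeasurable (Function.uncurry w'))
    (C1 : ENNReal) (hC1 : C1 ≠ ⊤) (hwC : ∀ t ∈ Set.Icc 0 T, ∫⁻ ω, ‖w t ω‖ₑ ∂P ≤ C1)
    (hwC' : ∀ t ∈ Set.Icc 0 T, ∫⁻ ω, ‖w' t ω‖ₑ ∂P ≤ C1)
    (hwE : ∀ t ∈ Set.Icc 0 T, ∀ᵐ ω ∂P, w t ω = a t ω + ∫ s, G t s (w s ω) ∂μ)
    (hwE' : ∀ t ∈ Set.Icc 0 T, ∀ᵐ ω ∂P, w' t ω = a t ω + ∫ s, G t s (w' s ω) ∂μ) :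
    ∀ t ∈ Set.Icc 0 T, ∀ᵐ ω ∂P, w' t ω = w t ω := by
  have hsec : ∀ w : ℝ → Ω → E, StronglyMeasurable (Function.uncurry w) → ∀ t ω,
      AEStronglyMeasurable (fun s => G t s (w s ω)) μ := by
    intro w hw t ω
    exact ((hGm w hw).comp_measurable (g := fun s : ℝ => ((t, ω), s)) measurable_prodMk_left).aestronglyMeasurable
  have hd : StronglyMeasurable (fun p : ℝ × Ω => w' p.1 p.2 - w p.1 p.2) := hw'.sub hw
  have hm : Measurable (fun p : Ω × ℝ => ENNReal.ofReal (k p.2) * ‖w' p.2 p.1 - w p.2 p.1‖ₑ) := by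
    refine (hkm.comp measurable_snd).ennreal_ofReal.mul ?_
    exact hd.enorm.comp measurable_swap
  set S : ENNReal := ⨆ t ∈ Set.Icc 0 T, ∫⁻ ω, ‖w' t ω - w t ω‖ₑ ∂P with hS
  have hSt : S ≠ ⊤ := by
    refine ne_of_lt (lt_of_le_of_lt (b := C1 + C1) ?_ (ENNReal.add_lt_top.2 ⟨hC1.lt_top, hC1.lt_top⟩))
    refine iSup₂_le fun t ht => ?_
    refine le_trans ?_ (add_le_add (hwC' t ht) (hwC t ht))
    rw [← lintegral_add_left]
    · exact lintegral_mono fun ω => enorm_sub_le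
    · exact hw'.enorm.comp measurable_prodMk_left
  have hSle : ∀ t ∈ Set.Icc 0 T, ∫⁻ ω, ‖w' t ω - w t ω‖ₑ ∂P ≤ S := fun t ht =>
    le_iSup₂ (f := fun t (_ : t ∈ Set.Icc 0 T) => ∫⁻ ω, ‖w' t ω - w t ω‖ₑ ∂P) t ht
  have hI := abs_ae_integrable P μ hμ k hk hkm hk0 w hw C1 hC1 hwC
  have hI' := abs_ae_integrable P μ hμ k hk hkm hk0 w' hw' C1 hC1 hwC'
  have hSS : S ≤ ENNReal.ofReal q * S := by
    refine iSup₂_le fun t ht => ?_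
    have h1 : ∀ᵐ ω ∂P, ‖w' t ω - w t ω‖ₑ ≤
        ∫⁻ s, ENNReal.ofReal (k s) * ‖w' s ω - w s ω‖ₑ ∂μ := by
      filter_upwards [hI, hI', hwE t ht, hwE' t ht] with ω i i' e e'
      rw [e, e', add_sub_add_left_eq_sub, ← integral_sub
        (abs_integrable (hG1 t ht) hk (hG0 t ht) (hsec w' hw' t ω) i')
        (abs_integrable (hG1 t ht) hk (hG0 t ht) (hsec w hw t ω) i)]
      refine (enorm_integral_le_lintegral_enorm _).trans (lintegral_mono_ae ?_)
      filter_upwards [hG1 t ht] with s hs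
      rw [← ofReal_norm_eq_enorm, ← ofReal_norm_eq_enorm, ← ENNReal.ofReal_mul (hk0 s)]
      exact ENNReal.ofReal_le_ofReal (hs _ _)
    refine (lintegral_mono_ae h1).trans ?_
    rw [lintegral_lintegral_swap hm.aemeasurable]
    calc _ ≤ ∫⁻ s, ENNReal.ofReal (k s) * S ∂μ := by
          refine lintegral_mono_ae ?_
          filter_upwards [hμ] with s hs
          rw [lintegral_const_mul]
          · gcongr; exact hSle s hs
          · exact hd.enorm.comp measurable_prodMk_left
      _ ≤ _ := by
          rw [lintegral_mul_const _ hkm.ennreal_ofReal,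
            ← ofReal_integral_eq_lintegral_ofReal hk (Filter.Eventually.of_forall hk0)]
          gcongr
  have hS0 : S = 0 := by
    by_contra h0
    have : ENNReal.ofReal q * S < 1 * S :=
      ENNReal.mul_lt_mul_left h0 hSt (by rw [ENNReal.ofReal_lt_one]; exact hq1)
    rw [one_mul] at this
    exact absurd hSS (not_le.2 this)
  intro t ht
  have h0 : ∫⁻ ω, ‖w' t ω - w t ω‖ₑ ∂P = 0 := le_antisymm ((hSle t ht).trans hS0.le) bot_le
  have hdm : Measurable (fun ω => ‖w' t ω - w t ω‖ₑ) := hd.enorm.comp measurable_prodMk_left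
  rw [lintegral_eq_zero_iff hdm] at h0
  filter_upwards [h0] with ω hω
  simpa [sub_eq_zero] using hω

end abstractPart

section concretePart

lemma ml_summable {α M₁ M₂ : ℝ} (hM₁ : 0 < M₁)
    (hML : ∀ z : ℝ, 0 ≤ z →
      M₁ / (1 + z) ≤ mittagLeffler α 1 (-z) ∧ mittagLeffler α 1 (-z) ≤ M₂ / (1 + z)) (z : ℝ) :
    Summable (fun i : ℕ => z ^ i / Real.Gamma (α * i + 1)) := by
  have h : Summable (fun i : ℕ => (-|z|) ^ i / Real.Gamma (α * i + 1)) := by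
    by_contra hn
    have h1 := (hML |z| (abs_nonneg z)).1
    rw [mittagLeffler, tsum_eq_zero_of_not_summable hn] at h1
    have : 0 < M₁ / (1 + |z|) := by positivity
    linarith
  refine Summable.of_norm_bounded h.norm fun i => le_of_eq ?_
  simp

lemma ml_measurable {α M₁ M₂ : ℝ} (hM₁ : 0 < M₁)
    (hML : ∀ z : ℝ, 0 ≤ z →
      M₁ / (1 + z) ≤ mittagLeffler α 1 (-z) ∧ mittagLeffler α 1 (-z) ≤ M₂ / (1 + z)) :
    Measurable (mittagLeffler α 1) := by
  refine measurable_of_tendsto_metrizable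
    (f := fun n z => ∑ i ∈ Finset.range n, z ^ i / Real.Gamma (α * i + 1)) ?_ ?_
  · intro n; fun_prop
  · exact tendsto_pi_nhds.2 fun z => (ml_summable hM₁ hML z).hasSum.tendsto_sum_nat

lemma H2_norm_le {m : ℝ} (hm : 0 ≤ m) (g h : H2)
    (hj : ∀ j : J2, |(h : ∀ _ : J2, ℝ) j| ≤ m * |(g : ∀ _ : J2, ℝ) j|) : ‖h‖ ≤ m * ‖g‖ := by
  have : ‖h‖ ≤ ‖m • g‖ := by
    refine lp.norm_mono (by norm_num) fun j => ?_
    have := hj j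
    simpa [lp.coeFn_smul, abs_mul, abs_of_nonneg hm] using this
  rwa [norm_smul, Real.norm_of_nonneg hm] at this

lemma H2_mult_sm {X : Type*} [MeasurableSpace X] (P : J2 → Prop) [DecidablePred P]
    (hP : {j | P j}.Finite)
    (c : X → J2 → ℝ) (hc : ∀ j, Measurable fun x => c x j) (g h : X → H2)
    (hg : ∀ j, Measurable fun x => (g x : ∀ _ : J2, ℝ) j)
    (hh : ∀ x j, (h x : ∀ _ : J2, ℝ) j = (if P j then c x j else 0) * (g x : ∀ _ : J2, ℝ) j) :
    StronglyMeasurable h := by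
  classical
  have : h = fun x => ∑ j ∈ hP.toFinset,
      (c x j * (g x : ∀ _ : J2, ℝ) j) • (lp.single 2 j (1 : ℝ) : H2) := by
    funext x
    ext j
    rw [hh, lp.coeFn_sum, Finset.sum_apply]
    simp only [lp.coeFn_smul, Pi.smul_apply, lp.single_apply, smul_eq_mul]
    by_cases hj : P j
    · rw [Finset.sum_eq_single j]
      · simp [hj]
      · intro b _ hb
        rw [Pi.single_eq_of_ne (Ne.symm hb)]; simp
      · intro h'; simp [hj] at h'
    · rw [Finset.sum_eq_zero]
      · simp [hj]
      · intro b hb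
        have : j ≠ b := by rintro rfl; simp [hj] at hb
        rw [Pi.single_eq_of_ne this]; simp
  rw [this]
  refine Finset.stronglyMeasurable_fun_sum _ fun j _ => ?_
  exact ((hc j).mul (hg j)).stronglyMeasurable.smul_const _

lemma J2_fin (N₁ N₂ : ℕ) : {j : J2 | (j.1 : ℕ) ≤ N₁ ∧ (j.2 : ℕ) ≤ N₂}.Finite := by
  have hf : ∀ N : ℕ, {n : ℕ+ | (n : ℕ) ≤ N}.Finite := fun N =>
    (Set.finite_Iic N).preimage (f := fun n : ℕ+ => (n : ℕ)) PNat.coe_injective.injOn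
  exact (hf N₁).prod (hf N₂)

lemma H2_coord_measurable [MeasurableSpace H2] [BorelSpace H2] (j : J2) :
    Measurable (fun g : H2 => (g : ∀ _ : J2, ℝ) j) :=
  (lp.evalCLM ℝ (fun _ : J2 => ℝ) 2 j).continuous.measurable

lemma H2_coord_continuous (j : J2) :
    Continuous (fun g : H2 => (g : ∀ _ : J2, ℝ) j) :=
  (lp.evalCLM ℝ (fun _ : J2 => ℝ) 2 j).continuous

lemma lam2_nonneg (j : J2) : 0 ≤ lam2 j := by unfold lam2; positivity

lemma ker_int {α T : ℝ} (hα1 : α < 1) (hT : 0 < T) :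
    Integrable (fun s => |T - s| ^ (-α)) (volume.restrict (Set.Ioc 0 T)) ∧
    ∫ s in Set.Ioc 0 T, |T - s| ^ (-α) = T ^ (1 - α) / (1 - α) := by
  have h1 : IntervalIntegrable (fun s : ℝ => (T - s) ^ (-α)) volume 0 T := by
    have := (intervalIntegral.intervalIntegrable_rpow' (a := 0) (b := T) (r := -α)
      (by linarith)).comp_sub_left T
    simpa using this.symm
  have hc : ∀ s ∈ Set.Ioc 0 T, |T - s| ^ (-α) = (T - s) ^ (-α) := by
    intro s hs
    rw [abs_of_nonneg (by linarith [hs.2])]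
  constructor
  · have := (intervalIntegrable_iff_integrableOn_Ioc_of_le hT.le).1 h1
    exact this.congr_fun (fun s hs => (hc s hs).symm) measurableSet_Ioc
  · rw [setIntegral_congr_fun measurableSet_Ioc hc, ← intervalIntegral.integral_of_le hT.le,
      intervalIntegral.integral_comp_sub_left (fun x => x ^ (-α)) T, integral_rpow (by left; linarith)]
    rw [sub_self, sub_zero, Real.zero_rpow (by linarith), show -α + 1 = 1 - α by ring, sub_zero]

lemma Q_bound {α T M₁ M₂ K : ℝ} (hα1 : α < 1) (hT : 0 < T) (hM₁ : 0 < M₁) (hM₂ : 0 < M₂)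
    (hK0 : 0 < K) (hKQ : K < (Qconst α T M₁ M₂)⁻¹) :
    K * (M₂ * T + M₂ ^ 2 / M₁ * (T / (1 - α))) < 1 := by
  have ha : 0 < 1 - α := by linarith
  have hQ0 : 0 < Qconst α T M₁ M₂ := by unfold Qconst; positivity
  have h1 : K * Qconst α T M₁ M₂ < 1 := by
    rwa [lt_inv_comm₀ hK0 hQ0, inv_eq_one_div, lt_div_iff₀ hK0, mul_comm] at hKQ
  refine lt_of_le_of_lt (mul_le_mul_of_nonneg_left ?_ hK0.le) h1
  have h2 : M₁ * (1 - α) + M₂ ≤ Real.sqrt (2 * (M₁ ^ 2 * (1 - α) ^ 2 + M₂ ^ 2)) := by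
    apply Real.le_sqrt_of_sq_le
    nlinarith [sq_nonneg (M₁ * (1 - α) - M₂)]
  have h3 : 0 < M₁ * (1 - α) + M₂ := by positivity
  rw [Qconst, le_div_iff₀ (by positivity)]
  calc _ = M₂ * T * (M₁ * (1 - α) + M₂) := by field_simp
    _ ≤ 2 * M₂ * T * (M₁ * (1 - α) + M₂) := by
      have : 0 < M₂ * T * (M₁ * (1 - α) + M₂) := by positivity
      linarith
    _ ≤ _ := by gcongr

lemma mult_bounds {α T M₁ M₂ : ℝ} (hα0 : 0 < α) (hT : 0 < T) (hM₁ : 0 < M₁) (hM₂ : 0 < M₂)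
    (hML : ∀ z : ℝ, 0 ≤ z →
      M₁ / (1 + z) ≤ mittagLeffler α 1 (-z) ∧ mittagLeffler α 1 (-z) ≤ M₂ / (1 + z))
    (l : ℝ) (hl : 0 ≤ l) :
    (∀ t, 0 ≤ t → |mittagLeffler α 1 (-(l * t ^ α))| ≤ M₂) ∧
    (∀ t, 0 ≤ t → |mittagLeffler α 1 (-(l * t ^ α)) / mittagLeffler α 1 (-(l * T ^ α))|
      ≤ M₂ / M₁ * (1 + l * T ^ α)) ∧
    (∀ t s, 0 ≤ t → 0 ≤ s → s < T → |mittagLeffler α 1 (-(l * t ^ α)) /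
      mittagLeffler α 1 (-(l * T ^ α)) * mittagLeffler α 1 (-(l * (T - s) ^ α))|
      ≤ M₂ ^ 2 / M₁ * (T ^ α * |T - s| ^ (-α))) := by
  have hz : ∀ t : ℝ, 0 ≤ t → 0 ≤ l * t ^ α := fun t ht => mul_nonneg hl (Real.rpow_nonneg ht _)
  have hpos : ∀ t : ℝ, 0 ≤ t → 0 < mittagLeffler α 1 (-(l * t ^ α)) := fun t ht =>
    lt_of_lt_of_le (div_pos hM₁ (by linarith [hz t ht])) (hML _ (hz t ht)).1
  have hub : ∀ t : ℝ, 0 ≤ t → mittagLeffler α 1 (-(l * t ^ α)) ≤ M₂ := fun t ht =>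
    (hML _ (hz t ht)).2.trans (div_le_self hM₂.le (by linarith [hz t ht]))
  have hTz := hz T hT.le
  have hinv : (mittagLeffler α 1 (-(l * T ^ α)))⁻¹ ≤ (1 + l * T ^ α) / M₁ := by
    rw [← inv_div]
    exact inv_anti₀ (by positivity) (hML _ hTz).1
  have hratio : ∀ t, 0 ≤ t → |mittagLeffler α 1 (-(l * t ^ α)) / mittagLeffler α 1 (-(l * T ^ α))|
      ≤ M₂ / M₁ * (1 + l * T ^ α) := by
    intro t ht
    rw [abs_of_pos (div_pos (hpos t ht) (hpos T hT.le)), div_eq_mul_inv]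
    calc _ ≤ M₂ * ((1 + l * T ^ α) / M₁) :=
          mul_le_mul (hub t ht) hinv (inv_nonneg.2 (hpos T hT.le).le) hM₂.le
      _ = _ := by ring
  refine ⟨fun t ht => by rw [abs_of_pos (hpos t ht)]; exact hub t ht, hratio, ?_⟩
  intro t s ht hs0 hs
  have hTs : 0 < T - s := by linarith
  have hp : 0 < (T - s) ^ α := Real.rpow_pos_of_pos hTs _
  rw [abs_mul, abs_of_pos (hpos (T - s) hTs.le), abs_of_pos hTs, Real.rpow_neg hTs.le]
  have h1 : (T - s) ^ α ≤ T ^ α := Real.rpow_le_rpow hTs.le (by linarith) hα0.le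
  have hden : 0 < 1 + l * (T - s) ^ α := by positivity
  calc _ ≤ (M₂ / M₁ * (1 + l * T ^ α)) * (M₂ / (1 + l * (T - s) ^ α)) :=
        mul_le_mul (hratio t ht) (hML _ (hz _ hTs.le)).2 (hpos _ hTs.le).le (by positivity)
    _ = M₂ ^ 2 / M₁ * ((1 + l * T ^ α) / (1 + l * (T - s) ^ α)) := by ring
    _ ≤ _ := by
      refine mul_le_mul_of_nonneg_left ?_ (by positivity)
      rw [← div_eq_mul_inv, div_le_div_iff₀ hden hp]
      nlinarith

end concretePart

theorem stmt_14 (α T M₁ M₂ : ℝ)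
    (hα0 : 0 < α) (hα1 : α < 1) (hT : 0 < T) (hM₁ : 0 < M₁) (hM₂ : 0 < M₂)
    (hML : ∀ z : ℝ, 0 ≤ z →
      M₁ / (1 + z) ≤ mittagLeffler α 1 (-z) ∧ mittagLeffler α 1 (-z) ≤ M₂ / (1 + z))
    (N₁ N₂ : ℕ) (hN₁ : 0 < N₁) (hN₂ : 0 < N₂)
    (A B : ℝ → H2 →L[ℝ] H2)
    (hA : ∀ t : ℝ, ∀ g : H2, ∀ j : J2, (A t g : ∀ _ : J2, ℝ) j =
      (if (j.1 : ℕ) ≤ N₁ ∧ (j.2 : ℕ) ≤ N₂ then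
        mittagLeffler α 1 (-(lam2 j * t ^ α)) / mittagLeffler α 1 (-(lam2 j * T ^ α))
      else 0) * (g : ∀ _ : J2, ℝ) j)
    (hB : ∀ t : ℝ, ∀ g : H2, ∀ j : J2, (B t g : ∀ _ : J2, ℝ) j =
      (if (j.1 : ℕ) ≤ N₁ ∧ (j.2 : ℕ) ≤ N₂ then
        mittagLeffler α 1 (-(lam2 j * t ^ α)) else 0) * (g : ∀ _ : J2, ℝ) j)
    {Ω : Type*} [MeasureSpace Ω] [IsProbabilityMeasure (ℙ : Measure Ω)]
    (ψ : Ω → H2) (hψmeas : StronglyMeasurable ψ)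
    (hψint : Integrable (fun ω => ‖ψ ω‖ ^ 2) (ℙ : Measure Ω))
    [MeasurableSpace H2] [BorelSpace H2]
    (f : ℝ → H2 → H2) (hfmeas : Measurable (Function.uncurry f))
    (hf0 : ∃ C : ℝ, ∀ t ∈ Set.Icc (0 : ℝ) T, ‖f t 0‖ ≤ C)
    (K : ℝ) (hK0 : 0 < K) (hKQ : K < (Qconst α T M₁ M₂)⁻¹)
    (hfLip : ∀ t : ℝ, ∀ u v : H2, ‖f t u - f t v‖ ≤ K * ‖u - v‖) :
    ∃ w : ℝ → Ω → H2, IsXTSol T A B ψ f w ∧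
      ∀ w' : ℝ → Ω → H2, IsXTSol T A B ψ f w' →
        ∀ t ∈ Set.Icc (0 : ℝ) T, ∀ᵐ ω ∂(ℙ : Measure Ω), w' t ω = w t ω := by
  classical
  obtain ⟨C0', hC0'⟩ := hf0
  set C0 := max C0' 0 with hC0def
  have hC0n : 0 ≤ C0 := le_max_right _ _
  have hC0 : ∀ t ∈ Set.Icc (0 : ℝ) T, ‖f t 0‖ ≤ C0 := fun t ht => (hC0' t ht).trans (le_max_left _ _)
  have hmb := fun j : J2 => mult_bounds hα0 hT hM₁ hM₂ hML (lam2 j) (lam2_nonneg j)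
  have hmlm := ml_measurable hM₁ hML
  -- operator bounds
  have hBn : ∀ t, 0 ≤ t → ∀ g, ‖B t g‖ ≤ M₂ * ‖g‖ := by
    intro t ht g
    refine H2_norm_le hM₂.le _ _ fun j => ?_
    rw [hB, abs_mul]
    refine mul_le_mul_of_nonneg_right ?_ (abs_nonneg _)
    split_ifs
    · exact (hmb j).1 t ht
    · simpa using hM₂.le
  set CA : ℝ := M₂ / M₁ * (1 + ((N₁ : ℝ) ^ 2 + (N₂ : ℝ) ^ 2) * T ^ α) with hCA
  have hTα : 0 < T ^ α := Real.rpow_pos_of_pos hT _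
  have hCA0 : 0 ≤ CA := by positivity
  have hAn : ∀ t, 0 ≤ t → ∀ g, ‖A t g‖ ≤ CA * ‖g‖ := by
    intro t ht g
    refine H2_norm_le hCA0 _ _ fun j => ?_
    rw [hA, abs_mul]
    refine mul_le_mul_of_nonneg_right ?_ (abs_nonneg _)
    split_ifs with hj
    · refine ((hmb j).2.1 t ht).trans ?_
      have h1 : lam2 j ≤ (N₁ : ℝ) ^ 2 + (N₂ : ℝ) ^ 2 := by
        have e1 : ((j.1 : ℕ) : ℝ) ≤ N₁ := by exact_mod_cast hj.1
        have e2 : ((j.2 : ℕ) : ℝ) ≤ N₂ := by exact_mod_cast hj.2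
        unfold lam2
        gcongr
      rw [hCA]
      gcongr
    · simpa using hCA0
  let L : ℝ → ℝ := fun s => M₂ ^ 2 / M₁ * (T ^ α * |T - s| ^ (-α))
  have hL0 : ∀ s, 0 ≤ L s := fun s => by
    have := Real.rpow_nonneg (abs_nonneg (T - s)) (-α)
    positivity
  have hABn : ∀ t s, 0 ≤ t → 0 ≤ s → s < T → ∀ g, ‖A t (B (T - s) g)‖ ≤ L s * ‖g‖ := by
    intro t s ht hs0 hs g
    refine H2_norm_le (hL0 s) _ _ fun j => ?_
    rw [hA, hB, ← mul_assoc, abs_mul]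
    refine mul_le_mul_of_nonneg_right ?_ (abs_nonneg _)
    split_ifs
    · exact (hmb j).2.2 t s ht hs0 hs
    · simpa using hL0 s
  -- the integrands
  let G1 : ℝ → ℝ → H2 → H2 := fun t s x => (Set.Iic t).indicator (fun s => B (t - s) (f s x)) s
  let G2 : ℝ → ℝ → H2 → H2 := fun t s x => A t (B (T - s) (f s x))
  let G : ℝ → ℝ → H2 → H2 := fun t s x => G1 t s x - G2 t s x
  let μ : Measure ℝ := volume.restrict (Set.Ioc 0 T)
  have hμo : ∀ᵐ s ∂μ, s ∈ Set.Ioo 0 T := by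
    have : μ = volume.restrict (Set.Ioo 0 T) := (Measure.restrict_congr_set Ioo_ae_eq_Ioc).symm
    rw [this]
    exact ae_restrict_mem measurableSet_Ioo
  have hμ : ∀ᵐ s ∂μ, s ∈ Set.Icc 0 T := by
    filter_upwards [hμo] with s hs using ⟨hs.1.le, hs.2.le⟩
  let k : ℝ → ℝ := fun s => K * (M₂ + L s)
  have hk0 : ∀ s, 0 ≤ k s := fun s => mul_nonneg hK0.le (add_nonneg hM₂.le (hL0 s))
  have hLm : Measurable L := by fun_prop
  have hkm : Measurable k := by fun_prop
  obtain ⟨hker1, hker2⟩ := ker_int hα1 hT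
  have hLi : Integrable L μ := (hker1.const_mul _).const_mul _
  have hk : Integrable k μ := ((integrable_const _).add hLi).const_mul _
  set q : ℝ := K * (M₂ * T + M₂ ^ 2 / M₁ * (T / (1 - α))) with hqdef
  have hq1 : q < 1 := Q_bound hα1 hT hM₁ hM₂ hK0 hKQ
  have hq : ∫ s, k s ∂μ ≤ q := by
    refine le_of_eq ?_
    have h1 : ∫ s, L s ∂μ = M₂ ^ 2 / M₁ * (T / (1 - α)) := by
      simp only [L, μ]
      rw [MeasureTheory.integral_const_mul, MeasureTheory.integral_const_mul, hker2, ← mul_div_assoc,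
        ← Real.rpow_add hT, add_sub_cancel, Real.rpow_one]
    have h2 : ∫ _s, M₂ ∂μ = M₂ * T := by
      simp [μ, hT.le, mul_comm]
    simp only [k]
    rw [MeasureTheory.integral_const_mul, integral_add (integrable_const _) hLi, h1, h2]
  have hG1a : ∀ t ∈ Set.Icc 0 T, ∀ s, ∀ x y,
      ‖G1 t s x - G1 t s y‖ ≤ K * M₂ * ‖x - y‖ := by
    intro t ht s x y
    by_cases hst : s ∈ Set.Iic t
    · simp only [G1, Set.indicator_of_mem hst, ← map_sub]
      calc _ ≤ M₂ * ‖f s x - f s y‖ := hBn _ (sub_nonneg.2 hst) _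
        _ ≤ M₂ * (K * ‖x - y‖) := by gcongr; exact hfLip s x y
        _ = _ := by ring
    · simp only [G1, Set.indicator_of_notMem hst, sub_zero, norm_zero]
      positivity
  have hG2a : ∀ t ∈ Set.Icc 0 T, ∀ s ∈ Set.Ioo 0 T, ∀ x y,
      ‖G2 t s x - G2 t s y‖ ≤ K * L s * ‖x - y‖ := by
    intro t ht s hs x y
    simp only [G2, ← map_sub]
    calc _ ≤ L s * ‖f s x - f s y‖ := hABn t s ht.1 hs.1.le hs.2 _
      _ ≤ L s * (K * ‖x - y‖) := mul_le_mul_of_nonneg_left (hfLip s x y) (hL0 s)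
      _ = _ := by ring
  have hG1z : ∀ t ∈ Set.Icc 0 T, ∀ s ∈ Set.Ioo 0 T, ‖G1 t s 0‖ ≤ K * M₂ * (C0 / K) := by
    intro t ht s hs
    have e : K * M₂ * (C0 / K) = M₂ * C0 := by field_simp
    rw [e]
    by_cases hst : s ∈ Set.Iic t
    · simp only [G1, Set.indicator_of_mem hst]
      calc _ ≤ M₂ * ‖f s 0‖ := hBn _ (sub_nonneg.2 hst) _
        _ ≤ M₂ * C0 := by gcongr; exact hC0 s ⟨hs.1.le, hs.2.le⟩
    · simp only [G1, Set.indicator_of_notMem hst, norm_zero]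
      positivity
  have hG2z : ∀ t ∈ Set.Icc 0 T, ∀ s ∈ Set.Ioo 0 T, ‖G2 t s 0‖ ≤ K * L s * (C0 / K) := by
    intro t ht s hs
    have e : K * L s * (C0 / K) = L s * C0 := by field_simp
    rw [e]
    calc _ ≤ L s * ‖f s 0‖ := hABn t s ht.1 hs.1.le hs.2 _
      _ ≤ L s * C0 := mul_le_mul_of_nonneg_left (hC0 s ⟨hs.1.le, hs.2.le⟩) (hL0 s)
  have hkk1 : ∀ s, K * M₂ ≤ k s := fun s => by
    simp only [k]; nlinarith [hL0 s, mul_nonneg hK0.le (hL0 s)]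
  have hkk2 : ∀ s, K * L s ≤ k s := fun s => by
    simp only [k]; nlinarith [hL0 s, mul_pos hK0 hM₂]
  have hCK : 0 ≤ C0 / K := by positivity
  have hG1' : ∀ t ∈ Set.Icc 0 T, ∀ᵐ s ∂μ, ∀ x y, ‖G t s x - G t s y‖ ≤ k s * ‖x - y‖ := by
    intro t ht
    filter_upwards [hμo] with s hs x y
    calc ‖G t s x - G t s y‖ = ‖(G1 t s x - G1 t s y) - (G2 t s x - G2 t s y)‖ := by
          simp only [G]; congr 1; abel
      _ ≤ _ := norm_sub_le _ _
      _ ≤ K * M₂ * ‖x - y‖ + K * L s * ‖x - y‖ :=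
        add_le_add (hG1a t ht s x y) (hG2a t ht s hs x y)
      _ = _ := by simp only [k]; ring
  have hG0' : ∀ t ∈ Set.Icc 0 T, ∀ᵐ s ∂μ, ‖G t s 0‖ ≤ k s * (C0 / K) := by
    intro t ht
    filter_upwards [hμo] with s hs
    calc ‖G t s 0‖ ≤ _ := norm_sub_le _ _
      _ ≤ K * M₂ * (C0 / K) + K * L s * (C0 / K) :=
        add_le_add (hG1z t ht s hs) (hG2z t ht s hs)
      _ = _ := by simp only [k]; ring
  -- measurability
  have hfw : ∀ w : ℝ → Ω → H2, StronglyMeasurable (Function.uncurry w) →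
      Measurable (fun p : (ℝ × Ω) × ℝ => f p.2 (w p.2 p.1.2)) := by
    intro w hw
    have h1 : Measurable (fun p : (ℝ × Ω) × ℝ => w p.2 p.1.2) :=
      hw.measurable.comp (measurable_snd.prodMk (measurable_snd.comp measurable_fst))
    exact hfmeas.comp (measurable_snd.prodMk h1)
  have hG1m : ∀ w : ℝ → Ω → H2, StronglyMeasurable (Function.uncurry w) →
      StronglyMeasurable (fun p : (ℝ × Ω) × ℝ => G1 p.1.1 p.2 (w p.2 p.1.2)) := by
    intro w hw
    have hs : MeasurableSet {p : (ℝ × Ω) × ℝ | p.2 ≤ p.1.1} :=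
      measurableSet_le measurable_snd (measurable_fst.comp measurable_fst)
    have h1 : StronglyMeasurable
        (fun p : (ℝ × Ω) × ℝ => B (p.1.1 - p.2) (f p.2 (w p.2 p.1.2))) := by
      refine H2_mult_sm (fun j => (j.1 : ℕ) ≤ N₁ ∧ (j.2 : ℕ) ≤ N₂) (J2_fin N₁ N₂)
        (fun p j => mittagLeffler α 1 (-(lam2 j * (p.1.1 - p.2) ^ α))) ?_
        (fun p => f p.2 (w p.2 p.1.2)) _ ?_ ?_
      · intro j; exact hmlm.comp (by fun_prop)
      · intro j; exact (H2_coord_measurable j).comp (hfw w hw)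
      · intro p j; exact hB _ _ _
    have h2 := h1.indicator hs
    have h3 : (fun p : (ℝ × Ω) × ℝ => G1 p.1.1 p.2 (w p.2 p.1.2)) =
        {p : (ℝ × Ω) × ℝ | p.2 ≤ p.1.1}.indicator
          (fun p : (ℝ × Ω) × ℝ => B (p.1.1 - p.2) (f p.2 (w p.2 p.1.2))) := by
      funext p
      simp only [G1, Set.indicator_apply, Set.mem_Iic, Set.mem_setOf_eq]
    rw [h3]
    exact h2
  have hG2m : ∀ w : ℝ → Ω → H2, StronglyMeasurable (Function.uncurry w) →
      StronglyMeasurable (fun p : (ℝ × Ω) × ℝ => G2 p.1.1 p.2 (w p.2 p.1.2)) := by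
    intro w hw
    refine H2_mult_sm (fun j => (j.1 : ℕ) ≤ N₁ ∧ (j.2 : ℕ) ≤ N₂) (J2_fin N₁ N₂)
        (fun p j => mittagLeffler α 1 (-(lam2 j * p.1.1 ^ α)) /
          mittagLeffler α 1 (-(lam2 j * T ^ α)) *
          mittagLeffler α 1 (-(lam2 j * (T - p.2) ^ α))) ?_
        (fun p => f p.2 (w p.2 p.1.2)) _ ?_ ?_
    · intro j
      exact ((hmlm.comp (by fun_prop)).div_const _).mul (hmlm.comp (by fun_prop))
    · intro j; exact (H2_coord_measurable j).comp (hfw w hw)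
    · intro p j
      simp only [G2]
      rw [hA, hB]
      split_ifs <;> ring
  have hGm : ∀ w : ℝ → Ω → H2, StronglyMeasurable (Function.uncurry w) →
      StronglyMeasurable (fun p : (ℝ × Ω) × ℝ => G p.1.1 p.2 (w p.2 p.1.2)) :=
    fun w hw => (hG1m w hw).sub (hG2m w hw)
  let a : ℝ → Ω → H2 := fun t ω => A t (ψ ω)
  have ham : StronglyMeasurable (Function.uncurry a) := by
    refine H2_mult_sm (fun j => (j.1 : ℕ) ≤ N₁ ∧ (j.2 : ℕ) ≤ N₂) (J2_fin N₁ N₂)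
        (fun p j => mittagLeffler α 1 (-(lam2 j * p.1 ^ α)) /
          mittagLeffler α 1 (-(lam2 j * T ^ α))) ?_ (fun p => ψ p.2) _ ?_ ?_
    · intro j
      exact (hmlm.comp (by fun_prop)).div_const _
    · intro j; exact (H2_coord_measurable j).comp (hψmeas.measurable.comp measurable_snd)
    · intro p j; exact hA _ _ _
  -- translation of the integral equation
  have htrans : ∀ w : ℝ → Ω → H2, StronglyMeasurable (Function.uncurry w) → ∀ ω,
      Integrable (fun s => k s * ‖w s ω‖) μ → ∀ t ∈ Set.Icc 0 T,
      A t (ψ ω) + (∫ s in (0 : ℝ)..t, B (t - s) (f s (w s ω)))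
        - (∫ s in (0 : ℝ)..T, A t (B (T - s) (f s (w s ω))))
      = a t ω + ∫ s, G t s (w s ω) ∂μ := by
    intro w hw ω hi t ht
    have i1 : Integrable (fun s => G1 t s (w s ω)) μ := by
      refine abs_integrable (k := k) (C := C0 / K) (G := G1 t) ?_ hk ?_ ?_ hi
      · refine Filter.Eventually.of_forall fun s x y => (hG1a t ht s x y).trans ?_
        exact mul_le_mul_of_nonneg_right (hkk1 s) (norm_nonneg _)
      · filter_upwards [hμo] with s hs
        exact (hG1z t ht s hs).trans (mul_le_mul_of_nonneg_right (hkk1 s) hCK)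
      · exact ((hG1m w hw).comp_measurable (g := fun s : ℝ => ((t, ω), s))
          measurable_prodMk_left).aestronglyMeasurable
    have i2 : Integrable (fun s => G2 t s (w s ω)) μ := by
      refine abs_integrable (k := k) (C := C0 / K) (G := G2 t) ?_ hk ?_ ?_ hi
      · filter_upwards [hμo] with s hs x y
        exact (hG2a t ht s hs x y).trans (mul_le_mul_of_nonneg_right (hkk2 s) (norm_nonneg _))
      · filter_upwards [hμo] with s hs
        exact (hG2z t ht s hs).trans (mul_le_mul_of_nonneg_right (hkk2 s) hCK)
      · exact ((hG2m w hw).comp_measurable (g := fun s : ℝ => ((t, ω), s))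
          measurable_prodMk_left).aestronglyMeasurable
    have e1 : (∫ s in (0 : ℝ)..t, B (t - s) (f s (w s ω))) = ∫ s, G1 t s (w s ω) ∂μ := by
      have : (fun s => G1 t s (w s ω)) =
          (Set.Iic t).indicator (fun s => B (t - s) (f s (w s ω))) := by
        funext s
        by_cases hst : s ∈ Set.Iic t
        · simp only [G1, Set.indicator_of_mem hst]
        · simp only [G1, Set.indicator_of_notMem hst]
      rw [this]
      simp only [μ]
      rw [setIntegral_indicator measurableSet_Iic, Set.Ioc_inter_Iic, min_eq_right ht.2,
        intervalIntegral.integral_of_le ht.1]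
    have e2 : (∫ s in (0 : ℝ)..T, A t (B (T - s) (f s (w s ω)))) = ∫ s, G2 t s (w s ω) ∂μ :=
      intervalIntegral.integral_of_le hT.le
    rw [e1, e2]
    simp only [G]
    rw [integral_sub i1 i2, add_sub_assoc]
  -- first-moment bounds
  have hfirst : ∀ w : ℝ → Ω → H2, ∀ C : ℝ,
      (∀ t ∈ Set.Icc (0 : ℝ) T, Integrable (fun ω => ‖w t ω‖ ^ 2) (ℙ : Measure Ω) ∧
        (∫ ω, ‖w t ω‖ ^ 2 ∂(ℙ : Measure Ω)) ≤ C) →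
      ∀ t ∈ Set.Icc (0 : ℝ) T, ∫⁻ ω, ‖w t ω‖ₑ ∂(ℙ : Measure Ω) ≤ ENNReal.ofReal (1 + C) := by
    intro w C h t ht
    obtain ⟨h1, h2⟩ := h t ht
    have hint : Integrable (fun ω => 1 + ‖w t ω‖ ^ 2) (ℙ : Measure Ω) :=
      (integrable_const _).add h1
    calc ∫⁻ ω, ‖w t ω‖ₑ ∂(ℙ : Measure Ω)
        ≤ ∫⁻ ω, ENNReal.ofReal (1 + ‖w t ω‖ ^ 2) ∂(ℙ : Measure Ω) := by
          refine lintegral_mono fun ω => ?_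
          rw [← ofReal_norm_eq_enorm]
          refine ENNReal.ofReal_le_ofReal ?_
          nlinarith [sq_nonneg (‖w t ω‖ - 1)]
      _ = ENNReal.ofReal (∫ ω, (1 + ‖w t ω‖ ^ 2) ∂(ℙ : Measure Ω)) :=
          (ofReal_integral_eq_lintegral_ofReal hint
            (Filter.Eventually.of_forall fun ω => by positivity)).symm
      _ ≤ _ := by
          refine ENNReal.ofReal_le_ofReal ?_
          rw [integral_add (integrable_const _) h1]
          simpa using h2
  obtain ⟨w, hwm, hwb, hwe⟩ := abs_exist (Ω := Ω) hT.le μ hμ k hk hk0 q hq hq1 G hG1' (C0 / K) hCK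
    hG0' hGm a ham (fun ω => CA * ‖ψ ω‖) (fun t ht ω => hAn t ht.1 _)
  have hwL2 : ∃ C : ℝ, ∀ t ∈ Set.Icc (0 : ℝ) T,
      Integrable (fun ω => ‖w t ω‖ ^ 2) (ℙ : Measure Ω) ∧
      (∫ ω, ‖w t ω‖ ^ 2 ∂(ℙ : Measure Ω)) ≤ C := by
    let bd : Ω → ℝ := fun ω =>
      (2 * CA ^ 2 * ‖ψ ω‖ ^ 2 + 2 * (q * (C0 / K)) ^ 2) / (1 - q) ^ 2
    have hbd : Integrable bd (ℙ : Measure Ω) :=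
      ((hψint.const_mul _).add (integrable_const _)).div_const _
    have hle : ∀ t ∈ Set.Icc (0 : ℝ) T, ∀ ω, ‖w t ω‖ ^ 2 ≤ bd ω := by
      intro t ht ω
      calc ‖w t ω‖ ^ 2 ≤ ((CA * ‖ψ ω‖ + q * (C0 / K)) / (1 - q)) ^ 2 :=
            pow_le_pow_left₀ (norm_nonneg _) (hwb t ht ω) 2
        _ ≤ bd ω := by
          simp only [bd]
          rw [div_pow]
          refine div_le_div_of_nonneg_right ?_ (sq_nonneg _)
          nlinarith [sq_nonneg (CA * ‖ψ ω‖ - q * (C0 / K))]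
    refine ⟨∫ ω, bd ω ∂(ℙ : Measure Ω), fun t ht => ?_⟩
    have hi : Integrable (fun ω => ‖w t ω‖ ^ 2) (ℙ : Measure Ω) := by
      refine Integrable.mono' hbd ?_ ?_
      · exact ((hwm.comp_measurable (measurable_prodMk_left (x := t))).norm.pow 2).aestronglyMeasurable
      · refine Filter.Eventually.of_forall fun ω => ?_
        rw [Real.norm_of_nonneg (sq_nonneg _)]
        exact hle t ht ω
    exact ⟨hi, MeasureTheory.integral_mono hi hbd (hle t ht)⟩
  obtain ⟨Cw, hCw⟩ := hwL2
  have hIw := abs_ae_integrable (ℙ : Measure Ω) μ hμ k hk hkm hk0 w hwm _ ENNReal.ofReal_ne_top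
    (hfirst w Cw hCw)
  refine ⟨w, ⟨hwm, ⟨Cw, hCw⟩, fun t ht => ?_⟩, ?_⟩
  · filter_upwards [hIw] with ω hω
    rw [htrans w hwm ω hω t ht]
    exact hwe t ht ω
  · rintro w' ⟨hwm', ⟨Cw', hCw'⟩, hwe'⟩
    have hIw' := abs_ae_integrable (ℙ : Measure Ω) μ hμ k hk hkm hk0 w' hwm' _
      ENNReal.ofReal_ne_top (hfirst w' Cw' hCw')
    refine abs_unique (ℙ : Measure Ω) μ hμ k hk hkm hk0 q hq hq1 G hG1' (C0 / K) hG0' hGm a w w'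
      hwm hwm' (ENNReal.ofReal (1 + Cw) + ENNReal.ofReal (1 + Cw'))
      (ENNReal.add_ne_top.2 ⟨ENNReal.ofReal_ne_top, ENNReal.ofReal_ne_top⟩)
      (fun t ht => (hfirst w Cw hCw t ht).trans le_self_add)
      (fun t ht => (hfirst w' Cw' hCw' t ht).trans le_add_self)
      (fun t ht => Filter.Eventually.of_forall fun ω => hwe t ht ω) ?_
    intro t ht
    filter_upwards [hIw', hwe' t ht] with ω hω e
    rw [← htrans w' hwm' ω hω t ht]
    exact e
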